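/- arXiv:1005.4583 — 2 statements merged into one kernel-verified Lean document; each statement's English description precedes it below -/
import Mathlib

section
/- For every integer n ≥ 1, the following identity holds in ℤ[β,t,u,v,w]: Σ_{σ∈D_n} β^{cyc σ} t^{exc σ} u^{cda σ} v^{cdd σ} w^{cvalley σ} = Σ_{k=0}^{⌊n/2⌋} c_{n,k}(β) · t^k · (tu+v)^{n−2k} · w^k, where c_{n,k}(β) = Σ_{σ∈D_n(k)} β^{cyc σ} and D_n(k) is the set of derangements of [n] with exactly k cyclic valleys and no double drops. -/
open scoped Classical
open Finset

noncomputable section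

namespace SZpaper

/-- `σ` as a 1-indexed function on `[1,n]`, extended by `0` elsewhere
(boundary convention `σ(0)=σ(n+1)=0`). -/
def pext (n : ℕ) (σ : Equiv.Perm (Fin n)) (i : ℕ) : ℕ :=
  if h : 1 ≤ i ∧ i ≤ n then ((σ ⟨i - 1, by omega⟩ : Fin n) : ℕ) + 1 else 0

/-- `σ` extended with the Brändén boundary convention `σ(0)=σ(n+1)=n+1`. -/
def pextB (n : ℕ) (σ : Equiv.Perm (Fin n)) (i : ℕ) : ℕ :=
  if h : 1 ≤ i ∧ i ≤ n then ((σ ⟨i - 1, by omega⟩ : Fin n) : ℕ) + 1 else n + 1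

/-- `σ` extended with the boundary convention `σ(0)=0`, `σ(n+1)=n+1`. -/
def pextC (n : ℕ) (σ : Equiv.Perm (Fin n)) (i : ℕ) : ℕ :=
  if h : 1 ≤ i ∧ i ≤ n then ((σ ⟨i - 1, by omega⟩ : Fin n) : ℕ) + 1
  else if i = 0 then 0 else n + 1

/-- The set of pairs `(i,j)` with `i, j ∈ [1,n]`. -/
def pairs (n : ℕ) : Finset (ℕ × ℕ) := Finset.Icc 1 n ×ˢ Finset.Icc 1 n

/-- `des σ = #{i ∈ [n−1] : σ(i) > σ(i+1)}`. -/
def desStat (n : ℕ) (σ : Equiv.Perm (Fin n)) : ℕ :=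
  ((Finset.Icc 1 (n - 1)).filter fun i => pext n σ (i + 1) < pext n σ i).card

/-- `les σ = #{(i,j) : 2 ≤ i < j ≤ n, σ(i−1) > σ(j) > σ(i)}`. -/
def lesStat (n : ℕ) (σ : Equiv.Perm (Fin n)) : ℕ :=
  ((pairs n).filter fun x => 2 ≤ x.1 ∧ x.1 < x.2 ∧
    pext n σ x.1 < pext n σ x.2 ∧ pext n σ x.2 < pext n σ (x.1 - 1)).card

/-- `less σ = #{(i,j) : 2 ≤ i < j ≤ n, σ(i−1) < σ(j) < σ(i)}`. -/
def lessStat (n : ℕ) (σ : Equiv.Perm (Fin n)) : ℕ :=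
  ((pairs n).filter fun x => 2 ≤ x.1 ∧ x.1 < x.2 ∧
    pext n σ (x.1 - 1) < pext n σ x.2 ∧ pext n σ x.2 < pext n σ x.1).card

/-- `res σ = #{(i,j) : 1 ≤ i < j ≤ n−1, σ(j+1) > σ(i) > σ(j)}`. -/
def resStat (n : ℕ) (σ : Equiv.Perm (Fin n)) : ℕ :=
  ((pairs n).filter fun x => x.1 < x.2 ∧ x.2 ≤ n - 1 ∧
    pext n σ x.2 < pext n σ x.1 ∧ pext n σ x.1 < pext n σ (x.2 + 1)).card

/-- `ress σ = #{(i,j) : 1 ≤ i < j ≤ n−1, σ(j+1) < σ(i) < σ(j)}`. -/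
def ressStat (n : ℕ) (σ : Equiv.Perm (Fin n)) : ℕ :=
  ((pairs n).filter fun x => x.1 < x.2 ∧ x.2 ≤ n - 1 ∧
    pext n σ (x.2 + 1) < pext n σ x.1 ∧ pext n σ x.1 < pext n σ x.2).card

/-! Linear statistics with the boundary convention `σ(0)=σ(n+1)=0` (starred). -/

def peakStar (n : ℕ) (σ : Equiv.Perm (Fin n)) : ℕ :=
  ((Finset.Icc 1 n).filter fun i =>
    pext n σ (i - 1) < pext n σ i ∧ pext n σ (i + 1) < pext n σ i).card

def valleyStar (n : ℕ) (σ : Equiv.Perm (Fin n)) : ℕ :=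
  ((Finset.Icc 1 n).filter fun i =>
    pext n σ i < pext n σ (i - 1) ∧ pext n σ i < pext n σ (i + 1)).card

def daStar (n : ℕ) (σ : Equiv.Perm (Fin n)) : ℕ :=
  ((Finset.Icc 1 n).filter fun i =>
    pext n σ (i - 1) < pext n σ i ∧ pext n σ i < pext n σ (i + 1)).card

def ddStar (n : ℕ) (σ : Equiv.Perm (Fin n)) : ℕ :=
  ((Finset.Icc 1 n).filter fun i =>
    pext n σ (i + 1) < pext n σ i ∧ pext n σ i < pext n σ (i - 1)).card

/-! Linear statistics with the Brändén boundary convention `σ(0)=σ(n+1)=n+1`. -/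

def peakB (n : ℕ) (σ : Equiv.Perm (Fin n)) : ℕ :=
  ((Finset.Icc 1 n).filter fun i =>
    pextB n σ (i - 1) < pextB n σ i ∧ pextB n σ (i + 1) < pextB n σ i).card

def valleyB (n : ℕ) (σ : Equiv.Perm (Fin n)) : ℕ :=
  ((Finset.Icc 1 n).filter fun i =>
    pextB n σ i < pextB n σ (i - 1) ∧ pextB n σ i < pextB n σ (i + 1)).card

def daB (n : ℕ) (σ : Equiv.Perm (Fin n)) : ℕ :=
  ((Finset.Icc 1 n).filter fun i =>
    pextB n σ (i - 1) < pextB n σ i ∧ pextB n σ i < pextB n σ (i + 1)).card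

def ddB (n : ℕ) (σ : Equiv.Perm (Fin n)) : ℕ :=
  ((Finset.Icc 1 n).filter fun i =>
    pextB n σ (i + 1) < pextB n σ i ∧ pextB n σ i < pextB n σ (i - 1)).card

/-! Linear statistics with the boundary convention `σ(0)=0`, `σ(n+1)=n+1`. -/

def valleyC (n : ℕ) (σ : Equiv.Perm (Fin n)) : ℕ :=
  ((Finset.Icc 1 n).filter fun i =>
    pextC n σ i < pextC n σ (i - 1) ∧ pextC n σ i < pextC n σ (i + 1)).card

def daC (n : ℕ) (σ : Equiv.Perm (Fin n)) : ℕ :=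
  ((Finset.Icc 1 n).filter fun i =>
    pextC n σ (i - 1) < pextC n σ i ∧ pextC n σ i < pextC n σ (i + 1)).card

def ddC (n : ℕ) (σ : Equiv.Perm (Fin n)) : ℕ :=
  ((Finset.Icc 1 n).filter fun i =>
    pextC n σ (i + 1) < pextC n σ i ∧ pextC n σ i < pextC n σ (i - 1)).card

/-- `fmax σ`: the number of double ascents (convention `σ(0)=0`, `σ(n+1)=n+1`)
which are left-to-right maxima. -/
def fmaxStat (n : ℕ) (σ : Equiv.Perm (Fin n)) : ℕ :=
  ((Finset.Icc 1 n).filter fun i =>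
    pextC n σ (i - 1) < pextC n σ i ∧ pextC n σ i < pextC n σ (i + 1) ∧
    ∀ j ∈ Finset.Ico 1 i, pext n σ j < pext n σ i).card

/-! Cyclic statistics. -/

def excStat (n : ℕ) (σ : Equiv.Perm (Fin n)) : ℕ :=
  ((Finset.Icc 1 n).filter fun i => i < pext n σ i).card

def wexStat (n : ℕ) (σ : Equiv.Perm (Fin n)) : ℕ :=
  ((Finset.Icc 1 n).filter fun i => i ≤ pext n σ i).card

def dropStat (n : ℕ) (σ : Equiv.Perm (Fin n)) : ℕ :=
  ((Finset.Icc 1 n).filter fun i => pext n σ i < i).card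

def fixStat (n : ℕ) (σ : Equiv.Perm (Fin n)) : ℕ :=
  ((Finset.Icc 1 n).filter fun i => pext n σ i = i).card

/-- cyclic valleys: `x` with `σ⁻¹(x) > x < σ(x)`. -/
def cvalleyStat (n : ℕ) (σ : Equiv.Perm (Fin n)) : ℕ :=
  ((Finset.Icc 1 n).filter fun x => x < pext n σ⁻¹ x ∧ x < pext n σ x).card

/-- double excedances: `x` with `σ⁻¹(x) < x < σ(x)`. -/
def cdaStat (n : ℕ) (σ : Equiv.Perm (Fin n)) : ℕ :=
  ((Finset.Icc 1 n).filter fun x => pext n σ⁻¹ x < x ∧ x < pext n σ x).card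

/-- double drops: `x` with `σ⁻¹(x) > x > σ(x)`. -/
def cddStat (n : ℕ) (σ : Equiv.Perm (Fin n)) : ℕ :=
  ((Finset.Icc 1 n).filter fun x => x < pext n σ⁻¹ x ∧ pext n σ x < x).card

/-- crossings. -/
def crosStat (n : ℕ) (σ : Equiv.Perm (Fin n)) : ℕ :=
  ((pairs n).filter fun x =>
    (x.1 < x.2 ∧ x.2 ≤ pext n σ x.1 ∧ pext n σ x.1 < pext n σ x.2) ∨
    (x.2 < x.1 ∧ pext n σ x.1 < x.2 ∧ pext n σ x.2 < pext n σ x.1)).card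

/-- nestings. -/
def nestStat (n : ℕ) (σ : Equiv.Perm (Fin n)) : ℕ :=
  ((pairs n).filter fun x =>
    (x.1 < x.2 ∧ x.2 ≤ pext n σ x.2 ∧ pext n σ x.2 < pext n σ x.1) ∨
    (x.2 < x.1 ∧ pext n σ x.2 < x.2 ∧ pext n σ x.1 < pext n σ x.2)).card

/-- number of cycles of `σ` (fixed points count as cycles). -/
def cycStat (n : ℕ) (σ : Equiv.Perm (Fin n)) : ℕ :=
  Multiset.card σ.cycleType + (Finset.univ.filter fun x => σ x = x).card

/-! Star statistics: `σ*(i) = σ(i) − 1`, a bijection `[n] → {0,…,n−1}`;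
we extend `σ*` by `0` outside `[1,n]`. -/

def starf (n : ℕ) (σ : Equiv.Perm (Fin n)) (i : ℕ) : ℕ :=
  if 1 ≤ i ∧ i ≤ n then pext n σ i - 1 else 0

/-- `(σ*)⁻¹(i) = σ⁻¹(i+1)`, defined for `0 ≤ i ≤ n−1`. -/
def invstarf (n : ℕ) (σ : Equiv.Perm (Fin n)) (i : ℕ) : ℕ :=
  pext n σ⁻¹ (i + 1)

def dropStarStat (n : ℕ) (σ : Equiv.Perm (Fin n)) : ℕ :=
  ((Finset.Icc 1 n).filter fun i => starf n σ i < i).card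

def fixStarStat (n : ℕ) (σ : Equiv.Perm (Fin n)) : ℕ :=
  ((Finset.Icc 1 n).filter fun i => starf n σ i = i).card

def wexStarStat (n : ℕ) (σ : Equiv.Perm (Fin n)) : ℕ :=
  ((Finset.Icc 1 n).filter fun i => i ≤ starf n σ i).card

def cdaStarStat (n : ℕ) (σ : Equiv.Perm (Fin n)) : ℕ :=
  ((Finset.Icc 1 n).filter fun i => invstarf n σ i < i ∧ i < starf n σ i).card

def cddStarStat (n : ℕ) (σ : Equiv.Perm (Fin n)) : ℕ :=
  ((Finset.Icc 1 n).filter fun i => i < invstarf n σ i ∧ starf n σ i < i).card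

def cvalleyStarStat (n : ℕ) (σ : Equiv.Perm (Fin n)) : ℕ :=
  ((Finset.Icc 1 n).filter fun i => i < invstarf n σ i ∧ i < starf n σ i).card

def crosStarStat (n : ℕ) (σ : Equiv.Perm (Fin n)) : ℕ :=
  ((pairs n).filter fun x =>
    (x.1 < x.2 ∧ x.2 ≤ starf n σ x.1 ∧ starf n σ x.1 < starf n σ x.2) ∨
    (x.2 < x.1 ∧ starf n σ x.1 < x.2 ∧ starf n σ x.2 < starf n σ x.1)).card

def nestStarStat (n : ℕ) (σ : Equiv.Perm (Fin n)) : ℕ :=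
  ((pairs n).filter fun x =>
    (x.1 < x.2 ∧ x.2 ≤ starf n σ x.2 ∧ starf n σ x.2 < starf n σ x.1) ∨
    (x.2 < x.1 ∧ starf n σ x.2 < x.2 ∧ starf n σ x.1 < starf n σ x.2)).card

/-- `cyc* σ`: the number of cycles of the functional digraph of `σ*` on `[n]`,
counted as the number of `i ∈ [1,n]` that lie on a cycle of `σ*` and are
minimal in their cycle. (The component of `σ*` that is a path from `n` to `0`
contributes no such `i`.) -/
def cycStarStat (n : ℕ) (σ : Equiv.Perm (Fin n)) : ℕ :=
  ((Finset.Icc 1 n).filter fun i =>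
    (∃ m ∈ Finset.Icc 1 n, (starf n σ)^[m] i = i) ∧
    ∀ m ∈ Finset.range (n + 1), i ≤ (starf n σ)^[m] i).card

/-! Motzkin paths, encoded as step sequences `γ : Fin m → Fin 3`
(`0` = up step `(1,1)`, `1` = level step `(1,0)`, `2` = down step `(1,−1)`). -/

/-- The height (ordinate) of the path after `i` steps. -/
def hgt (m : ℕ) (γ : Fin m → Fin 3) (i : ℕ) : ℤ :=
  ∑ j ∈ Finset.range i, if hj : j < m then 1 - ((γ ⟨j, hj⟩ : ℕ) : ℤ) else 0

/-- A step sequence is a Motzkin path if it never goes below the x-axis and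
ends at height `0`. -/
def IsMotzkin (m : ℕ) (γ : Fin m → Fin 3) : Prop :=
  (∀ i ≤ m, 0 ≤ hgt m γ i) ∧ hgt m γ m = 0

/-- The (finite) set of Motzkin paths of length `m`. -/
def motzkin (m : ℕ) : Finset (Fin m → Fin 3) :=
  Finset.univ.filter fun γ => IsMotzkin m γ

/-- number of up (North-East) steps. -/
def neCount (m : ℕ) (γ : Fin m → Fin 3) : ℕ :=
  (Finset.univ.filter fun i => γ i = 0).card

/-- number of level (East) steps. -/
def eCount (m : ℕ) (γ : Fin m → Fin 3) : ℕ :=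
  (Finset.univ.filter fun i => γ i = 1).card

/-- the `(p,q)`-integer `[m]_{p,q} = p^{m−1} + p^{m−2}q + ⋯ + q^{m−1}`. -/
def pqInt {R : Type*} [CommRing R] (p q : R) (m : ℕ) : R :=
  ∑ j ∈ Finset.range m, p ^ (m - 1 - j) * q ^ j

open MvPolynomial in
/-- `c_{n,k}(β)` (with `β = X 0`), as an element of `ℤ[β,t,u,v,w]`. -/
def cPoly5 (n k : ℕ) : MvPolynomial (Fin 5) ℤ :=
  ∑ σ ∈ Finset.univ.filter
      (fun σ : Equiv.Perm (Fin n) =>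
        fixStat n σ = 0 ∧ cvalleyStat n σ = k ∧ cddStat n σ = 0),
    X 0 ^ cycStat n σ

/-! ### Cycle counts -/

section CycleCount

open Equiv Equiv.Perm

variable {α : Type*} [Fintype α] [DecidableEq α]

/-- Splitting `x` off a nontrivial cycle, for a permutation consisting of that cycle. -/
lemma IsCycle.card_swap_mul {c : Perm α} (hc : c.IsCycle) {x : α} (hx : c x ≠ x) :
    Multiset.card (swap x (c x) * c).cycleType + c.support.card =
      Multiset.card c.cycleType + (swap x (c x) * c).support.card + 1 := by
  by_cases h : c (c x) = x
  · have hs : c = swap x (c x) := hc.eq_swap_of_apply_apply_eq_self hx h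
    have h1 : swap x (c x) * c = 1 := by
      conv_lhs => rw [hs]
      simp
    have h2 : c.support.card = 2 := card_support_eq_two.mpr ⟨x, c x, hx.symm, hs⟩
    have h3 : Multiset.card c.cycleType = 1 := card_cycleType_eq_one.mpr hc
    rw [h1, h2, h3]
    simp
  · have h1 : Multiset.card c.cycleType = 1 := card_cycleType_eq_one.mpr hc
    have h2 : Multiset.card (swap x (c x) * c).cycleType = 1 :=
      card_cycleType_eq_one.mpr (hc.swap_mul hx h)
    have hmem : x ∈ c.support := mem_support.mpr hx
    rw [h1, h2, support_swap_mul_eq c x h, sdiff_singleton_eq_erase, card_erase_of_mem hmem]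
    have := card_pos.mpr ⟨x, hmem⟩
    omega

/-- Turning a non-fixed point `x` into a fixed point by short-circuiting it. -/
lemma card_cycleType_swap_mul (τ : Perm α) {x : α} (hx : τ x ≠ x) :
    Multiset.card (swap x (τ x) * τ).cycleType + τ.support.card =
      Multiset.card τ.cycleType + (swap x (τ x) * τ).support.card + 1 := by
  set c := τ.cycleOf x with hc_def
  have hcx : c x = τ x := cycleOf_apply_self τ x
  have hc : c.IsCycle := isCycle_cycleOf τ hx
  have hmem : c ∈ τ.cycleFactorsFinset :=
    cycleOf_mem_cycleFactorsFinset_iff.mpr (mem_support.mpr hx)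
  have hd : Perm.Disjoint (τ * c⁻¹) c := disjoint_mul_inv_of_mem_cycleFactorsFinset hmem
  set r := τ * c⁻¹ with hr
  have hτ : τ = c * r := by
    rw [← hd.commute.eq, hr, inv_mul_cancel_right]
  have hd' : Perm.Disjoint (swap x (c x) * c) r := by
    rw [disjoint_iff_disjoint_support]
    refine (disjoint_iff_disjoint_support.mp hd.symm).mono_left ?_
    intro y hy
    by_contra hyc
    rw [notMem_support] at hyc
    have hyx : y ≠ x := fun h => by rw [h, hcx] at hyc; exact hx hyc
    have hyx' : y ≠ c x := fun h => hyx (by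
      apply c.injective
      rw [hyc, h])
    rw [mem_support, mul_apply, hyc, swap_apply_of_ne_of_ne hyx hyx'] at hy
    exact hy rfl
  have hcard := IsCycle.card_swap_mul hc (x := x) (by rw [hcx]; exact hx)
  rw [← hcx]
  have e1 : swap x (c x) * τ = swap x (c x) * c * r := by rw [hτ, mul_assoc]
  rw [e1, hd'.cycleType_mul, hd'.card_support_mul, hτ, hd.symm.cycleType_mul,
    hd.symm.card_support_mul]
  simp only [Multiset.card_add]
  omega

end CycleCount

lemma cycStat_add_card_support (n : ℕ) (σ : Equiv.Perm (Fin n)) :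
    cycStat n σ + σ.support.card = Multiset.card σ.cycleType + n := by
  have h : (univ.filter fun x => σ x = x).card + σ.support.card = n := by
    have := card_filter_add_card_filter_not (s := (univ : Finset (Fin n))) (fun x => σ x = x)
    rw [card_univ, Fintype.card_fin] at this
    refine Eq.trans ?_ this
    congr 2
  unfold cycStat
  omega

lemma decomposeFin_symm_zero_eq_extendDomain {n : ℕ} (e : Equiv.Perm (Fin n)) :
    Equiv.Perm.decomposeFin.symm (0, e) = e.extendDomain (finSuccAboveEquiv 0) := by
  ext x
  refine Fin.cases ?_ (fun y => ?_) x
  · rw [Equiv.Perm.decomposeFin_symm_apply_zero, Equiv.Perm.extendDomain_apply_not_subtype]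
    simp
  · rw [Equiv.Perm.decomposeFin_symm_apply_succ]
    have := Equiv.Perm.extendDomain_apply_image e (finSuccAboveEquiv (0 : Fin (n + 1))) y
    simp only [finSuccAboveEquiv_apply, Fin.succAbove_zero] at this
    rw [this]
    simp

lemma cycStat_decomposeFin_symm_zero {n : ℕ} (e : Equiv.Perm (Fin n)) :
    cycStat (n + 1) (Equiv.Perm.decomposeFin.symm (0, e)) = cycStat n e + 1 := by
  have h1 := cycStat_add_card_support (n + 1) (Equiv.Perm.decomposeFin.symm (0, e))
  have h2 := cycStat_add_card_support n e
  rw [decomposeFin_symm_zero_eq_extendDomain] at h1 ⊢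
  rw [Equiv.Perm.cycleType_extendDomain, Equiv.Perm.card_support_extend_domain] at h1
  omega

lemma cycStat_decomposeFin_symm_succ {n : ℕ} (i : Fin n) (e : Equiv.Perm (Fin n)) :
    cycStat (n + 1) (Equiv.Perm.decomposeFin.symm (i.succ, e)) = cycStat n e := by
  set τ := Equiv.Perm.decomposeFin.symm (i.succ, e) with hτ
  have h0 : τ 0 = i.succ := Equiv.Perm.decomposeFin_symm_apply_zero _ _
  have hx : τ 0 ≠ 0 := by rw [h0]; exact Fin.succ_ne_zero i
  have hswap : Equiv.swap 0 (τ 0) * τ = Equiv.Perm.decomposeFin.symm (0, e) := by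
    rw [h0]
    ext x
    refine Fin.cases ?_ (fun y => ?_) x
    · simp [hτ]
    · simp [hτ]
  have h1 := card_cycleType_swap_mul τ hx
  rw [hswap] at h1
  have h2 := cycStat_add_card_support (n + 1) τ
  have h3 := cycStat_add_card_support (n + 1) (Equiv.Perm.decomposeFin.symm (0, e))
  rw [cycStat_decomposeFin_symm_zero] at h3
  omega

/-! ### Cyclic kinds of values -/

/-- The cyclic kind of a value `x`, determined by comparing it with `σ⁻¹ x` and `σ x`. -/
inductive Kind
  | fixed
  | asc
  | desc
  | peak
  | valley

instance : Fintype Kind :=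
  ⟨{Kind.fixed, Kind.asc, Kind.desc, Kind.peak, Kind.valley}, by rintro (_ | _) <;> simp⟩

/-- The kind of `x` when its preimage is `a` and its image is `c`. -/
def kindOf {α : Type*} [LinearOrder α] (a x c : α) : Kind :=
  if x < a then (if x < c then Kind.valley else Kind.desc)
  else if a < x then (if x < c then Kind.asc else Kind.peak)
  else Kind.fixed

/-- The cyclic kind of `x` in `σ`. -/
def kind {α : Type*} [LinearOrder α] (σ : Equiv.Perm α) (x : α) : Kind :=
  kindOf (σ⁻¹ x) x (σ x)

lemma kindOf_succ {n : ℕ} (a x c : Fin n) : kindOf a.succ x.succ c.succ = kindOf a x c := by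
  simp [kindOf]

section Insertion

variable {n : ℕ} (i : Fin n) (e : Equiv.Perm (Fin n))

lemma decomposeFin_symm_succ_apply (x : Fin n) :
    Equiv.Perm.decomposeFin.symm (i.succ, e) x.succ = if e x = i then 0 else (e x).succ := by
  rw [Equiv.Perm.decomposeFin_symm_apply_succ]
  split_ifs with h
  · rw [h, Equiv.swap_apply_right]
  · exact Equiv.swap_apply_of_ne_of_ne (Fin.succ_ne_zero _) (by simpa using h)

lemma decomposeFin_symm_succ_inv_apply (x : Fin n) :
    (Equiv.Perm.decomposeFin.symm (i.succ, e))⁻¹ x.succ =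
      if x = i then 0 else (e⁻¹ x).succ := by
  rw [Equiv.Perm.inv_eq_iff_eq]
  split_ifs with h
  · rw [h, Equiv.Perm.decomposeFin_symm_apply_zero]
  · rw [decomposeFin_symm_succ_apply]
    simp [h]

lemma kind_decomposeFin_symm_succ_zero :
    kind (Equiv.Perm.decomposeFin.symm (i.succ, e)) 0 = Kind.valley := by
  have h1 : 0 < (Equiv.Perm.decomposeFin.symm (i.succ, e))⁻¹ 0 := by
    rw [Fin.pos_iff_ne_zero, Ne, Equiv.Perm.inv_eq_iff_eq,
      Equiv.Perm.decomposeFin_symm_apply_zero]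
    exact (Fin.succ_ne_zero i).symm
  have h2 : 0 < Equiv.Perm.decomposeFin.symm (i.succ, e) 0 := by
    rw [Equiv.Perm.decomposeFin_symm_apply_zero]
    exact Fin.succ_pos i
  simp only [kind, kindOf, h1, h2, if_true]

lemma kind_decomposeFin_symm_zero_zero :
    kind (Equiv.Perm.decomposeFin.symm (0, e)) 0 = Kind.fixed := by
  have h1 : (Equiv.Perm.decomposeFin.symm (0, e))⁻¹ 0 = 0 := by
    rw [Equiv.Perm.inv_eq_iff_eq, Equiv.Perm.decomposeFin_symm_apply_zero]
  simp [kind, kindOf, h1]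

lemma kind_decomposeFin_symm_zero_succ (x : Fin n) :
    kind (Equiv.Perm.decomposeFin.symm (0, e)) x.succ = kind e x := by
  have h1 : (Equiv.Perm.decomposeFin.symm (0, e))⁻¹ x.succ = (e⁻¹ x).succ := by
    rw [Equiv.Perm.inv_eq_iff_eq, Equiv.Perm.decomposeFin_symm_apply_succ]
    simp
  have h2 : Equiv.Perm.decomposeFin.symm (0, e) x.succ = (e x).succ := by
    rw [Equiv.Perm.decomposeFin_symm_apply_succ]
    simp
  rw [kind, h1, h2, kindOf_succ, kind]

/-- The new kind of `x` when the minimum is inserted just before it in its cycle. -/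
def kindAfterHead (x : Fin n) : Kind := if x < e x then Kind.asc else Kind.peak

/-- The new kind of `x` when the minimum is inserted just after it in its cycle. -/
def kindAfterTail (x : Fin n) : Kind := if x < e⁻¹ x then Kind.desc else Kind.peak

lemma kind_decomposeFin_symm_succ_of_le (h : i ≤ e⁻¹ i) (x : Fin n) :
    kind (Equiv.Perm.decomposeFin.symm (i.succ, e)) x.succ =
      if x = i then kindAfterHead e x else kind e x := by
  rw [kind, decomposeFin_symm_succ_apply, decomposeFin_symm_succ_inv_apply]
  split_ifs with h1 h2 h2
  · have : ¬ x < e x := by rw [h2, h1]; exact lt_irrefl _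
    simp [kindOf, kindAfterHead, this]
  · simp [kindOf, kindAfterHead]
  · subst h2
    have hx : e⁻¹ (e x) = x := by simp
    rw [hx] at h
    have hlt : ¬ x < e x := not_lt.mpr h
    have : kindOf (e⁻¹ x).succ x.succ 0 = kindOf (e⁻¹ x) x (e x) := by
      simp [kindOf, hlt]
    rw [this, kind]
  · rw [kindOf_succ, kind]

lemma kind_decomposeFin_symm_succ_of_lt (h : e⁻¹ i < i) (x : Fin n) :
    kind (Equiv.Perm.decomposeFin.symm (i.succ, e)) x.succ =
      if x = e⁻¹ i then kindAfterTail e x else kind e x := by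
  have hxi : x = e⁻¹ i ↔ e x = i := by rw [eq_comm, Equiv.Perm.inv_eq_iff_eq, eq_comm]
  rw [kind, decomposeFin_symm_succ_apply, decomposeFin_symm_succ_inv_apply]
  simp only [hxi]
  split_ifs with h1 h2 h2
  · rw [← hxi] at h2
    rw [← h2, h1] at h
    exact absurd h (lt_irrefl _)
  · subst h1
    have hlt : ¬ x < e⁻¹ x := not_lt.mpr h.le
    simp [kindOf, kind, h, hlt, -Equiv.Perm.coe_inv]
  · have hxe : e⁻¹ x ≠ x := fun h' => h1 (by
      rw [← h2, ← Equiv.Perm.inv_eq_iff_eq, h'])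
    by_cases hlt : x < e⁻¹ x
    · simp [kindOf, kindAfterTail, hlt, -Equiv.Perm.coe_inv]
    · have : e⁻¹ x < x := lt_of_le_of_ne (not_lt.mp hlt) hxe
      simp [kindOf, kindAfterTail, hlt, this, -Equiv.Perm.coe_inv]
  · rw [kindOf_succ, kind]

end Insertion

/-! ### The generating polynomial -/

section GeneratingPolynomial

open MvPolynomial

variable {R : Type*} [CommRing R] (β : R)

/-- The product of the variables indexed by the kinds of all values. -/
def kindMonomial (R : Type*) [CommRing R] {n : ℕ} (σ : Equiv.Perm (Fin n)) :
    MvPolynomial Kind R :=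
  ∏ x, X (kind σ x)

/-- The generating polynomial of the kinds and of the number of cycles over `S_n`. -/
def kindPoly (n : ℕ) : MvPolynomial Kind R :=
  ∑ σ : Equiv.Perm (Fin n), C β ^ cycStat n σ * kindMonomial R σ

/-- The effect on a single value of inserting a new minimum next to it. -/
def insertionTerm (R : Type*) [CommRing R] : Kind → MvPolynomial Kind R
  | Kind.fixed => X Kind.peak
  | Kind.asc => X Kind.peak
  | Kind.desc => X Kind.peak
  | Kind.peak => 0
  | Kind.valley => X Kind.asc + X Kind.desc

/-- The derivation describing the insertion of a new minimum. -/
def insertionDerivation (R : Type*) [CommRing R] :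
    Derivation R (MvPolynomial Kind R) (MvPolynomial Kind R) :=
  mkDerivation R (insertionTerm R)

lemma insertionTerm_kind {n : ℕ} (e : Equiv.Perm (Fin n)) (x : Fin n) :
    insertionTerm R (kind e x) =
      (if x ≤ e⁻¹ x then X (kindAfterHead e x) else 0) +
        (if x < e x then X (kindAfterTail e x) else 0) := by
  have hfix : e⁻¹ x = x ↔ e x = x := by
    rw [Equiv.Perm.inv_eq_iff_eq, eq_comm]
  rcases lt_trichotomy x (e⁻¹ x) with h | h | h
  · by_cases h' : x < e x <;>
      simp [kind, kindOf, h, h', h.le, kindAfterHead, kindAfterTail, insertionTerm,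
        -Equiv.Perm.coe_inv]
  · have h2 : e x = x := hfix.mp h.symm
    simp [kind, kindOf, ← h, h2, kindAfterHead, insertionTerm, -Equiv.Perm.coe_inv]
  · by_cases h' : x < e x <;>
      simp [kind, kindOf, h, h', h.not_gt, h.not_ge, kindAfterTail, insertionTerm,
        -Equiv.Perm.coe_inv]

lemma derivation_prod {ι S A : Type*} [DecidableEq ι] [CommRing S] [CommRing A] [Algebra S A]
    (D : Derivation S A A) (s : Finset ι) (f : ι → A) :
    D (∏ i ∈ s, f i) = ∑ i ∈ s, (∏ j ∈ s.erase i, f j) * D (f i) := by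
  induction s using Finset.induction_on with
  | empty => simp
  | insert a s ha ih =>
    rw [prod_insert ha, Derivation.leibniz, ih, sum_insert ha, erase_insert ha, smul_eq_mul,
      smul_eq_mul, mul_sum, add_comm]
    congr 1
    refine sum_congr rfl fun i hi => ?_
    have hai : a ≠ i := fun h => ha (h ▸ hi)
    rw [erase_insert_of_ne hai, prod_insert fun h => ha (mem_of_mem_erase h), mul_assoc]

lemma insertionDerivation_kindMonomial {n : ℕ} (e : Equiv.Perm (Fin n)) :
    insertionDerivation R (kindMonomial R e) =
      ∑ x, (∏ y ∈ univ.erase x, X (kind e y)) * insertionTerm R (kind e x) := by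
  rw [kindMonomial, derivation_prod]
  simp [insertionDerivation, mkDerivation_X]

lemma kindMonomial_decomposeFin_symm_zero {n : ℕ} (e : Equiv.Perm (Fin n)) :
    kindMonomial R (Equiv.Perm.decomposeFin.symm (0, e)) =
      X Kind.fixed * kindMonomial R e := by
  simp only [kindMonomial, Fin.prod_univ_succ, kind_decomposeFin_symm_zero_zero,
    kind_decomposeFin_symm_zero_succ]

lemma prod_ite_eq_erase {n : ℕ} (f g : Fin n → Kind) (j : Fin n) :
    ∏ x, (X (if x = j then f x else g x) : MvPolynomial Kind R) =
      (∏ y ∈ univ.erase j, X (g y)) * X (f j) := by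
  rw [← prod_erase_mul _ _ (mem_univ j), if_pos rfl]
  congr 1
  refine prod_congr rfl fun y hy => ?_
  rw [if_neg (ne_of_mem_erase hy)]

lemma kindMonomial_decomposeFin_symm_succ {n : ℕ} (i : Fin n) (e : Equiv.Perm (Fin n)) :
    kindMonomial R (Equiv.Perm.decomposeFin.symm (i.succ, e)) =
      X Kind.valley *
        ((if i ≤ e⁻¹ i then (∏ y ∈ univ.erase i, X (kind e y)) * X (kindAfterHead e i) else 0) +
        (if e⁻¹ i < i then
          (∏ y ∈ univ.erase (e⁻¹ i), X (kind e y)) * X (kindAfterTail e (e⁻¹ i)) else 0)) := by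
  rw [kindMonomial, Fin.prod_univ_succ, kind_decomposeFin_symm_succ_zero]
  congr 1
  by_cases h : i ≤ e⁻¹ i
  · rw [if_pos h, if_neg h.not_gt, add_zero]
    simp only [kind_decomposeFin_symm_succ_of_le i e h, prod_ite_eq_erase]
  · have h' : e⁻¹ i < i := not_le.mp h
    rw [if_neg h, if_pos h', zero_add]
    simp only [kind_decomposeFin_symm_succ_of_lt i e h', prod_ite_eq_erase]

lemma sum_kindMonomial_decomposeFin_symm_succ {n : ℕ} (e : Equiv.Perm (Fin n)) :
    ∑ i : Fin n, kindMonomial R (Equiv.Perm.decomposeFin.symm (i.succ, e)) =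
      X Kind.valley * insertionDerivation R (kindMonomial R e) := by
  simp only [kindMonomial_decomposeFin_symm_succ, insertionDerivation_kindMonomial,
    insertionTerm_kind]
  rw [← mul_sum, sum_add_distrib]
  congr 1
  rw [← Equiv.sum_comp e (fun i => if e⁻¹ i < i then
    (∏ y ∈ univ.erase (e⁻¹ i), X (kind e y)) * X (kindAfterTail e (e⁻¹ i)) else
      (0 : MvPolynomial Kind R)), ← sum_add_distrib]
  refine sum_congr rfl fun x _ => ?_
  have hx : e⁻¹ (e x) = x := by simp
  simp only [hx, mul_add, mul_ite, mul_zero]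

lemma kindPoly_succ (n : ℕ) :
    kindPoly β (n + 1) = C β * X Kind.fixed * kindPoly β n +
      X Kind.valley * insertionDerivation R (kindPoly β n) := by
  have h : kindPoly β (n + 1) = ∑ e : Equiv.Perm (Fin n), ∑ j : Fin (n + 1),
      C β ^ cycStat (n + 1) (Equiv.Perm.decomposeFin.symm (j, e)) *
        kindMonomial R (Equiv.Perm.decomposeFin.symm (j, e)) := by
    rw [kindPoly, ← Equiv.sum_comp Equiv.Perm.decomposeFin.symm, Fintype.sum_prod_type_right]
  rw [h, kindPoly, map_sum, mul_sum, mul_sum, ← sum_add_distrib]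
  refine sum_congr rfl fun e _ => ?_
  rw [Fin.sum_univ_succ, cycStat_decomposeFin_symm_zero, kindMonomial_decomposeFin_symm_zero]
  simp only [cycStat_decomposeFin_symm_succ]
  rw [← mul_sum, sum_kindMonomial_decomposeFin_symm_succ, Derivation.leibniz, ← map_pow C β
    (cycStat n e), ← algebraMap_eq, Derivation.map_algebraMap]
  simp only [smul_eq_mul, map_pow]
  ring

/-- The polynomials which are symmetric under trading ascents for descents, in the strong sense
of depending only on the sum of the two variables. -/
def sumSubalgebra (R : Type*) [CommRing R] : Subalgebra R (MvPolynomial Kind R) :=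
  Algebra.adjoin R
    {X Kind.fixed, X Kind.peak, X Kind.valley, X Kind.asc + X Kind.desc}

lemma insertionDerivation_mem {p : MvPolynomial Kind R} (hp : p ∈ sumSubalgebra R) :
    insertionDerivation R p ∈ sumSubalgebra R := by
  have hpeak : (X Kind.peak : MvPolynomial Kind R) ∈ sumSubalgebra R :=
    Algebra.subset_adjoin (by simp)
  have hsum : (X Kind.asc + X Kind.desc : MvPolynomial Kind R) ∈ sumSubalgebra R :=
    Algebra.subset_adjoin (by simp)
  induction hp using Algebra.adjoin_induction with
  | mem x hx =>
    rcases hx with rfl | rfl | rfl | rfl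
    · simpa [insertionDerivation, mkDerivation_X, insertionTerm] using hpeak
    · simp [insertionDerivation, mkDerivation_X, insertionTerm]
    · simpa [insertionDerivation, mkDerivation_X, insertionTerm] using hsum
    · simpa [insertionDerivation, mkDerivation_X, insertionTerm] using add_mem hpeak hpeak
  | algebraMap r => rw [Derivation.map_algebraMap]; exact zero_mem _
  | add x y _ _ hx hy => rw [map_add]; exact add_mem hx hy
  | mul x y hxm hym hx hy =>
    rw [Derivation.leibniz, smul_eq_mul, smul_eq_mul]
    exact add_mem (mul_mem hxm hy) (mul_mem hym hx)

lemma kindPoly_mem (n : ℕ) : kindPoly β n ∈ sumSubalgebra R := by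
  induction n with
  | zero =>
    have : kindPoly β 0 = algebraMap R _ (β ^ cycStat 0 1) := by
      simp [kindPoly, kindMonomial, algebraMap_eq,
        Subsingleton.elim default (1 : Equiv.Perm (Fin 0))]
    rw [this]
    exact Subalgebra.algebraMap_mem _ _
  | succ n ih =>
    rw [kindPoly_succ, ← algebraMap_eq]
    refine add_mem (mul_mem (mul_mem (Subalgebra.algebraMap_mem _ _) ?_) ih)
      (mul_mem ?_ (insertionDerivation_mem ih)) <;>
    exact Algebra.subset_adjoin (by simp)

/-- Only the sum of the weights of `asc` and `desc` matters. -/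
lemma eval_kindPoly_congr (n : ℕ) {g g' : Kind → R} (hf : g Kind.fixed = g' Kind.fixed)
    (hp : g Kind.peak = g' Kind.peak) (hv : g Kind.valley = g' Kind.valley)
    (hs : g Kind.asc + g Kind.desc = g' Kind.asc + g' Kind.desc) :
    eval g (kindPoly β n) = eval g' (kindPoly β n) := by
  have hle : sumSubalgebra R ≤ AlgHom.equalizer (aeval g) (aeval g') := by
    refine Algebra.adjoin_le ?_
    rintro x (rfl | rfl | rfl | rfl) <;> simp [hf, hp, hv, hs]
  have h := hle (kindPoly_mem β n)
  simpa [aeval_eq_eval] using h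

/-- The number of values of a given kind. -/
def kindCount {n : ℕ} (σ : Equiv.Perm (Fin n)) (k : Kind) : ℕ :=
  (univ.filter fun x => kind σ x = k).card

lemma eval_kindPoly (n : ℕ) (g : Kind → R) :
    eval g (kindPoly β n) = ∑ σ : Equiv.Perm (Fin n), β ^ cycStat n σ *
      (g Kind.fixed ^ kindCount σ Kind.fixed * g Kind.asc ^ kindCount σ Kind.asc *
        g Kind.desc ^ kindCount σ Kind.desc * g Kind.peak ^ kindCount σ Kind.peak *
        g Kind.valley ^ kindCount σ Kind.valley) := by
  rw [kindPoly, map_sum]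
  refine sum_congr rfl fun σ _ => ?_
  rw [map_mul, map_pow, eval_C, kindMonomial, map_prod]
  simp only [eval_X]
  rw [← prod_fiberwise' univ (kind σ) g]
  simp only [prod_const]
  congr 1
  change ∏ k ∈ {Kind.fixed, Kind.asc, Kind.desc, Kind.peak, Kind.valley}, g k ^ kindCount σ k = _
  rw [prod_insert (by simp), prod_insert (by simp), prod_insert (by simp),
    prod_insert (by simp), prod_singleton]
  ring

end GeneratingPolynomial

/-! ### Statistics in terms of kinds -/

lemma card_filter_Icc_eq {n : ℕ} (σ : Equiv.Perm (Fin n)) (p : ℕ → ℕ → ℕ → Prop)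
    [∀ a x c, Decidable (p a x c)] :
    ((Icc 1 n).filter fun x => p (pext n σ⁻¹ x) x (pext n σ x)).card =
      (univ.filter fun x : Fin n => p ((σ⁻¹ x : Fin n) + 1) (x + 1) ((σ x : Fin n) + 1)).card := by
  symm
  have hp : ∀ (τ : Equiv.Perm (Fin n)) (x : Fin n), pext n τ (x + 1) = (τ x : ℕ) + 1 := by
    intro τ x
    have := x.isLt
    simp [pext]
  refine card_bij (fun x _ => (x : ℕ) + 1) ?_ ?_ ?_
  · intro x hx
    rw [mem_filter] at hx ⊢
    rw [hp, hp]
    exact ⟨by have := x.isLt; rw [mem_Icc]; omega, hx.2⟩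
  · intro x _ y _ h
    exact Fin.ext (by omega)
  · intro y hy
    rw [mem_filter, mem_Icc] at hy
    refine ⟨⟨y - 1, by omega⟩, ?_, by simp only; omega⟩
    rw [mem_filter, ← hp, ← hp]
    refine ⟨mem_univ _, ?_⟩
    have : y - 1 + 1 = y := by omega
    simpa only [this] using hy.2

section Statistics

variable {n : ℕ} (σ : Equiv.Perm (Fin n))

lemma inv_apply_eq_iff (x : Fin n) : σ⁻¹ x = x ↔ σ x = x := by
  rw [Equiv.Perm.inv_eq_iff_eq, eq_comm]

lemma kind_eq_fixed_iff (x : Fin n) : kind σ x = Kind.fixed ↔ σ x = x := by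
  have h := inv_apply_eq_iff σ x
  unfold kind kindOf
  grind

lemma kind_eq_valley_iff (x : Fin n) : kind σ x = Kind.valley ↔ x < σ⁻¹ x ∧ x < σ x := by
  have h := inv_apply_eq_iff σ x
  unfold kind kindOf
  grind

lemma kind_eq_asc_iff (x : Fin n) : kind σ x = Kind.asc ↔ σ⁻¹ x < x ∧ x < σ x := by
  have h := inv_apply_eq_iff σ x
  unfold kind kindOf
  grind

lemma kind_eq_desc_iff (x : Fin n) : kind σ x = Kind.desc ↔ x < σ⁻¹ x ∧ σ x < x := by
  have h := inv_apply_eq_iff σ x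
  unfold kind kindOf
  grind

lemma kind_eq_peak_iff (x : Fin n) : kind σ x = Kind.peak ↔ σ⁻¹ x < x ∧ σ x < x := by
  have h := inv_apply_eq_iff σ x
  unfold kind kindOf
  grind

lemma fixStat_eq : fixStat n σ = kindCount σ Kind.fixed := by
  rw [fixStat, card_filter_Icc_eq σ fun _ x c => c = x, kindCount]
  congr 1
  ext x
  simp only [mem_filter, mem_univ, true_and, add_left_inj, Fin.val_inj, kind_eq_fixed_iff]

lemma cvalleyStat_eq : cvalleyStat n σ = kindCount σ Kind.valley := by
  rw [cvalleyStat, card_filter_Icc_eq σ fun a x c => x < a ∧ x < c, kindCount]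
  congr 1
  ext x
  simp only [mem_filter, mem_univ, true_and, add_lt_add_iff_right, Fin.val_fin_lt,
    kind_eq_valley_iff]

lemma cdaStat_eq : cdaStat n σ = kindCount σ Kind.asc := by
  rw [cdaStat, card_filter_Icc_eq σ fun a x c => a < x ∧ x < c, kindCount]
  congr 1
  ext x
  simp only [mem_filter, mem_univ, true_and, add_lt_add_iff_right, Fin.val_fin_lt,
    kind_eq_asc_iff]

lemma cddStat_eq : cddStat n σ = kindCount σ Kind.desc := by
  rw [cddStat, card_filter_Icc_eq σ fun a x c => x < a ∧ c < x, kindCount]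
  congr 1
  ext x
  simp only [mem_filter, mem_univ, true_and, add_lt_add_iff_right, Fin.val_fin_lt,
    kind_eq_desc_iff]

lemma excStat_eq : excStat n σ = kindCount σ Kind.asc + kindCount σ Kind.valley := by
  rw [excStat, card_filter_Icc_eq σ fun _ x c => x < c, kindCount, kindCount,
    ← card_union_of_disjoint]
  · congr 1
    ext x
    have h := inv_apply_eq_iff σ x
    simp only [mem_filter, mem_union, mem_univ, true_and, add_lt_add_iff_right,
      Fin.val_fin_lt, kind_eq_asc_iff, kind_eq_valley_iff]
    grind
  · rw [disjoint_filter]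
    intro x _ h h'
    rw [h] at h'
    cases h'

/-- The heads of excedance arcs are the peaks and the double excedances. -/
lemma card_inv_apply_lt :
    (univ.filter fun x => σ⁻¹ x < x).card = kindCount σ Kind.asc + kindCount σ Kind.peak := by
  rw [kindCount, kindCount, ← card_union_of_disjoint]
  · congr 1
    ext x
    have h := inv_apply_eq_iff σ x
    simp only [mem_filter, mem_union, mem_univ, true_and, kind_eq_asc_iff, kind_eq_peak_iff]
    grind
  · rw [disjoint_filter]
    intro x _ h h'
    rw [h] at h'
    cases h'

lemma kindCount_peak_eq : kindCount σ Kind.peak = kindCount σ Kind.valley := by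
  have h1 := excStat_eq σ
  rw [excStat, card_filter_Icc_eq σ fun _ x c => x < c] at h1
  have h2 := card_inv_apply_lt σ
  have h3 : (univ.filter fun x => σ⁻¹ x < x).card =
      (univ.filter fun x : Fin n => (x : ℕ) + 1 < (σ x : ℕ) + 1).card := by
    refine card_bij (fun x _ => σ⁻¹ x) ?_ (fun _ _ _ _ h => σ⁻¹.injective h) ?_
    · intro x hx
      simpa using hx
    · intro y hy
      exact ⟨σ y, by simpa using hy, by simp⟩
  omega

lemma sum_kindCount : kindCount σ Kind.fixed + kindCount σ Kind.asc + kindCount σ Kind.desc +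
    kindCount σ Kind.peak + kindCount σ Kind.valley = n := by
  have h := card_eq_sum_card_fiberwise (f := kind σ) (s := univ) (t := univ)
    (fun _ _ => mem_coe.mpr (mem_univ _))
  rw [card_univ, Fintype.card_fin] at h
  change _ = ∑ k ∈ {Kind.fixed, Kind.asc, Kind.desc, Kind.peak, Kind.valley}, kindCount σ k at h
  rw [sum_insert (by simp), sum_insert (by simp), sum_insert (by simp),
    sum_insert (by simp), sum_singleton] at h
  omega

end Statistics

open MvPolynomial in
theorem statement12 (n : ℕ) (hn : 1 ≤ n) :
    (∑ σ ∈ Finset.univ.filter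
        (fun σ : Equiv.Perm (Fin n) => fixStat n σ = 0),
      (X 0 : MvPolynomial (Fin 5) ℤ) ^ cycStat n σ * X 1 ^ excStat n σ *
        X 2 ^ cdaStat n σ * X 3 ^ cddStat n σ * X 4 ^ cvalleyStat n σ) =
      ∑ k ∈ Finset.range (n / 2 + 1),
        cPoly5 n k * X 1 ^ k * (X 1 * X 2 + X 3) ^ (n - 2 * k) * X 4 ^ k := by
  let weight (a d : MvPolynomial (Fin 5) ℤ) : Kind → MvPolynomial (Fin 5) ℤ
    | Kind.fixed => 0
    | Kind.asc => a
    | Kind.desc => d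
    | Kind.peak => 1
    | Kind.valley => X 1 * X 4
  have key := eval_kindPoly_congr (X 0 : MvPolynomial (Fin 5) ℤ) n
    (g := weight (X 1 * X 2) (X 3)) (g' := weight (X 1 * X 2 + X 3) 0)
    rfl rfl rfl (by simp [weight])
  rw [eval_kindPoly, eval_kindPoly] at key
  rw [sum_filter]
  refine (Eq.trans (sum_congr rfl fun σ _ => ?_) key).trans ?_
  · rw [fixStat_eq, excStat_eq, cdaStat_eq, cddStat_eq, cvalleyStat_eq]
    simp only [weight]
    split_ifs with h
    · rw [h]
      ring
    · rw [zero_pow h]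
      ring
  · have hk : ∀ k, cPoly5 n k * X 1 ^ k * (X 1 * X 2 + X 3) ^ (n - 2 * k) * X 4 ^ k =
        ∑ σ : Equiv.Perm (Fin n), if cvalleyStat n σ = k then
          (if fixStat n σ = 0 ∧ cddStat n σ = 0 then
            X 0 ^ cycStat n σ * X 1 ^ k * (X 1 * X 2 + X 3) ^ (n - 2 * k) * X 4 ^ k else 0)
          else 0 := by
      intro k
      rw [cPoly5, sum_filter]
      simp only [sum_mul]
      refine sum_congr rfl fun σ _ => ?_
      split_ifs <;> simp_all
    simp only [hk]
    rw [sum_comm]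
    refine sum_congr rfl fun σ _ => ?_
    have hsum := sum_kindCount σ
    have hpeak := kindCount_peak_eq σ
    have hmem : cvalleyStat n σ ∈ range (n / 2 + 1) := by
      rw [mem_range, cvalleyStat_eq]
      omega
    rw [sum_ite_eq, if_pos hmem, fixStat_eq, cddStat_eq, cvalleyStat_eq]
    simp only [weight]
    split_ifs with h
    · have hasc : n - 2 * kindCount σ Kind.valley = kindCount σ Kind.asc := by omega
      rw [h.1, h.2, hasc]
      ring
    · rcases not_and_or.mp h with h | h <;> rw [zero_pow h] <;> ring

end SZpaper
end
end

section
/- For every integer n ≥ 1, the triples of statistics (res, les, des) and (ress, les, des) are equidistributed on S_n; that is, the following identity holds in ℤ[p,q,t]: Σ_{σ∈S_n} p^{res σ} q^{les σ} t^{des σ} = Σ_{σ∈S_n} p^{ress σ} q^{les σ} t^{des σ}. -/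
open scoped Classical
open Finset

noncomputable section

namespace SZpaper

/-! ### Weighted histories -/

/-- A step of a history: a pair of indicators (left neighbour larger, right neighbour smaller)
together with a nonnegative label. -/
abbrev Step : Type := (_ : ℕ × ℕ) × ℕ

/-- The steps allowed at height `k`, where `β k r` is the number of admissible labels. -/
def steps (β : ℕ → ℕ → ℕ) (k : ℕ) : Finset Step :=
  (range 2 ×ˢ range 2).sigma fun lr => range (β k lr.2)

/-- The histories with `n` steps from height `k` down to height `0`. -/
def histories (β : ℕ → ℕ → ℕ) : ℕ → ℕ → Finset (List Step)
  | 0, k => if k = 0 then {[]} else ∅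
  | n + 1, k => ((steps β k).sigma fun s => histories β n (k + s.1.1 - s.1.2)).image
      fun a => a.1 :: a.2

section Weights

variable {R : Type*} [CommSemiring R]

/-- The weight of a step taken at height `k`. -/
def stepWeight (β : ℕ → ℕ → ℕ) (p q t : R) (k : ℕ) (s : Step) : R :=
  p ^ (β k s.1.2 - 1 - s.2) * q ^ s.2 * t ^ s.1.2

/-- The weight of a history starting at height `k`. -/
def historyWeight (β : ℕ → ℕ → ℕ) (p q t : R) : ℕ → List Step → R
  | _, [] => 1
  | k, s :: l => stepWeight β p q t k s * historyWeight β p q t (k + s.1.1 - s.1.2) l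

/-- The total weight of the histories with `n` steps starting at height `k`. -/
def pathSum (β : ℕ → ℕ → ℕ) (p q t : R) : ℕ → ℕ → R
  | 0, k => if k = 0 then 1 else 0
  | n + 1, k => ∑ s ∈ steps β k, stepWeight β p q t k s *
      pathSum β p q t n (k + s.1.1 - s.1.2)

lemma sum_historyWeight (β : ℕ → ℕ → ℕ) (p q t : R) (n k : ℕ) :
    ∑ l ∈ histories β n k, historyWeight β p q t k l = pathSum β p q t n k := by
  induction n generalizing k with
  | zero =>
    by_cases hk : k = 0 <;> simp [histories, pathSum, hk, historyWeight]
  | succ n ih =>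
    rw [histories, sum_image, sum_sigma, pathSum]
    · refine sum_congr rfl fun s _ => ?_
      simp only [historyWeight]
      rw [← mul_sum, ih]
    · rintro ⟨s, l⟩ _ ⟨s', l'⟩ _ h
      simp only [List.cons.injEq] at h
      obtain ⟨rfl, rfl⟩ := h
      rfl

lemma historyWeight_one (β : ℕ → ℕ → ℕ) (k : ℕ) (l : List Step) :
    historyWeight β (1 : ℕ) 1 1 k l = 1 := by
  induction l generalizing k with
  | nil => rfl
  | cons s l ih => simp [historyWeight, stepWeight, ih]

lemma card_histories (β : ℕ → ℕ → ℕ) (n k : ℕ) :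
    (histories β n k).card = pathSum β (1 : ℕ) 1 1 n k := by
  rw [← sum_historyWeight]
  simp [historyWeight_one]

/-- The homogeneous `(p,q)`-integer over a commutative semiring. -/
def pqNat (p q : R) (m : ℕ) : R := ∑ g ∈ range m, p ^ (m - 1 - g) * q ^ g

lemma pqNat_zero (p q : R) : pqNat p q 0 = 0 := by simp [pqNat]

lemma pqNat_one (p q : R) : pqNat p q 1 = 1 := by simp [pqNat]

lemma pathSum_succ (β : ℕ → ℕ → ℕ) (p q t : R) (n k : ℕ) :
    pathSum β p q t (n + 1) k =
      pqNat p q (β k 0) * (pathSum β p q t n k + pathSum β p q t n (k + 1)) +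
      t * pqNat p q (β k 1) * (pathSum β p q t n (k - 1) + pathSum β p q t n k) := by
  rw [pathSum, steps, sum_sigma, sum_product]
  simp only [sum_range_succ, range_zero, sum_empty, stepWeight, pqNat, zero_add, pow_zero,
    pow_one, mul_one, add_zero, Nat.sub_zero, Nat.add_sub_cancel]
  simp only [← sum_mul]
  ring

/-- The number of labels in histories encoding `(ress, les, des)`. -/
def ressLabels (k r : ℕ) : ℕ := k + 1 - r

/-- The number of labels in histories encoding `(res, les, des)`. -/
def resLabels (k _r : ℕ) : ℕ := k

lemma pathSum_resLabels_succ_zero (p q t : R) (n : ℕ) :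
    pathSum resLabels p q t (n + 1) 0 = 0 := by
  simp [pathSum_succ, resLabels, pqNat_zero]

lemma pathSum_resLabels_succ_succ (p q t : R) (n k : ℕ) :
    pathSum resLabels p q t (n + 1) (k + 1) = t * pqNat p q (k + 1) *
      (pathSum ressLabels p q t n k + pathSum ressLabels p q t n (k + 1)) := by
  induction n generalizing k with
  | zero =>
    rw [pathSum_succ]
    simp [pathSum, resLabels]
  | succ n ih =>
    rw [pathSum_succ, ih, ih]
    cases k with
    | zero =>
      simp only [Nat.add_sub_cancel, pathSum_resLabels_succ_zero]
      rw [pathSum_succ ressLabels _ _ _ _ 0, pathSum_succ ressLabels _ _ _ _ (0 + 1)]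
      simp only [ressLabels, resLabels, Nat.add_sub_cancel, Nat.sub_zero, pqNat_zero]
      ring
    | succ k =>
      rw [Nat.add_sub_cancel, ih, pathSum_succ ressLabels _ _ _ _ (k + 1),
        pathSum_succ ressLabels _ _ _ _ (k + 1 + 1)]
      simp only [ressLabels, resLabels, Nat.add_sub_cancel, Nat.sub_zero]
      ring

lemma pathSum_resLabels_one (p q t : R) (n : ℕ) (hn : 1 ≤ n) :
    pathSum resLabels p q t n 1 = t * pathSum ressLabels p q t n 0 := by
  obtain ⟨n, rfl⟩ := Nat.exists_eq_add_of_le' hn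
  rw [pathSum_resLabels_succ_succ, pathSum_succ]
  simp [ressLabels, pqNat_zero, pqNat_one]

end Weights

lemma pathSum_ressLabels_one_one_one (n k : ℕ) :
    pathSum ressLabels (1 : ℕ) 1 1 n k = n.factorial * n.choose k := by
  induction n generalizing k with
  | zero => cases k <;> simp [pathSum]
  | succ n ih =>
    rw [pathSum_succ, ih, ih, ih]
    cases k with
    | zero =>
      simp [ressLabels, pqNat, Nat.factorial_succ]
      ring
    | succ k =>
      simp only [ressLabels, pqNat, one_pow, mul_one, sum_const, card_range, smul_eq_mul,
        Nat.add_sub_cancel, Nat.sub_zero, one_mul, Nat.factorial_succ]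
      have h1 := Nat.add_one_mul_choose_eq n k
      have h2 := Nat.add_one_mul_choose_eq n (k + 1)
      have h3 := Nat.choose_succ_succ n k
      have h4 := Nat.choose_succ_succ n (k + 1)
      simp only [Nat.succ_eq_add_one] at h3 h4
      rw [h3] at h1 ⊢
      rw [h4] at h2
      linear_combination (n.factorial : ℕ) * (-h1 - h2)

/-! ### Words and their crossings -/

/-- `w` lists each of the values `1, …, n` once, in the positions `1, …, n` recorded by `pos`,
and is followed by `0`. -/
structure IsWord (n : ℕ) (w pos : ℕ → ℕ) : Prop where
  pos_mem : ∀ x, 1 ≤ x → x ≤ n → 1 ≤ pos x ∧ pos x ≤ n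
  apply_pos : ∀ x, 1 ≤ x → x ≤ n → w (pos x) = x
  apply_mem : ∀ i, 1 ≤ i → i ≤ n → 1 ≤ w i ∧ w i ≤ n
  pos_apply : ∀ i, 1 ≤ i → i ≤ n → pos (w i) = i
  apply_end : w (n + 1) = 0

/-- The number of descents of `w` up to position `m` from a value `≥ x` to a value `< x`. -/
def downCross (w : ℕ → ℕ) (x m : ℕ) : ℕ :=
  ((Ico 1 m).filter fun i => w (i + 1) < x ∧ x ≤ w i).card

/-- The number of descents of `w` up to position `m` with bottom `x`. -/
def descBot (w : ℕ → ℕ) (m x : ℕ) : ℕ :=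
  ((Ico 1 m).filter fun i => w (i + 1) = x ∧ x < w i).card

/-- The number of descents of `w` up to position `m` with top `x`. -/
def descTop (w : ℕ → ℕ) (m x : ℕ) : ℕ :=
  ((Ico 1 m).filter fun i => w i = x ∧ w (i + 1) < x).card

lemma downCross_succ (w : ℕ → ℕ) (x m : ℕ) :
    downCross w (x + 1) m + descTop w m x = downCross w x m + descBot w m x := by
  simp only [downCross, descTop, descBot, card_filter, ← sum_add_distrib]
  refine sum_congr rfl fun i _ => ?_
  split_ifs <;> omega

lemma downCross_mono (w : ℕ → ℕ) (x : ℕ) {m m' : ℕ} (h : m ≤ m') :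
    downCross w x m ≤ downCross w x m' :=
  card_le_card (filter_subset_filter _ (Ico_subset_Ico_right h))

lemma downCross_add (w : ℕ → ℕ) (x : ℕ) {m m' : ℕ} (h1 : 1 ≤ m) (h : m ≤ m') :
    downCross w x m' = downCross w x m +
      ((Ico m m').filter fun i => w (i + 1) < x ∧ x ≤ w i).card := by
  simp only [downCross, card_filter]
  exact (sum_Ico_consecutive _ h1 h).symm

/-- From a position with value `≥ x` on, descents and ascents through `x` alternate. -/
lemma card_descents_through (w : ℕ → ℕ) (x : ℕ) {j m : ℕ} (hx : x ≤ w j) (h : j ≤ m) :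
    ((Ico j m).filter fun i => w (i + 1) < x ∧ x ≤ w i).card =
      ((Ico j m).filter fun i => w i < x ∧ x ≤ w (i + 1)).card + if w m < x then 1 else 0 := by
  induction m, h using Nat.le_induction with
  | base => simp; omega
  | succ m hm ih =>
    simp only [card_filter] at ih ⊢
    rw [sum_Ico_succ_top hm, sum_Ico_succ_top hm, ih]
    split_ifs <;> omega

namespace IsWord

variable {n : ℕ} {w pos w' pos' : ℕ → ℕ}

lemma pos_inj (h : IsWord n w pos) {x y : ℕ} (hx : 1 ≤ x) (hxn : x ≤ n) (hy : 1 ≤ y)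
    (hyn : y ≤ n) (hxy : pos x = pos y) : x = y := by
  rw [← h.apply_pos x hx hxn, hxy, h.apply_pos y hy hyn]

lemma eq_pos (h : IsWord n w pos) {x i : ℕ} (hx : 1 ≤ x) (hi : 1 ≤ i) (hin : i ≤ n + 1)
    (hw : w i = x) : i = pos x := by
  rcases Nat.lt_or_ge n i with h' | h'
  · obtain rfl : i = n + 1 := by omega
    have := h.apply_end
    omega
  · rw [← hw, h.pos_apply i hi h']

lemma apply_le (h : IsWord n w pos) {i : ℕ} (hi : 1 ≤ i) (hin : i ≤ n + 1) : w i ≤ n := by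
  rcases Nat.lt_or_ge n i with h' | h'
  · obtain rfl : i = n + 1 := by omega
    simp [h.apply_end]
  · exact (h.apply_mem i hi h').2

lemma descBot_le_one (h : IsWord n w pos) {x m : ℕ} (hx : 1 ≤ x) (hm : m ≤ n + 1) :
    descBot w m x ≤ 1 := by
  refine card_le_one.2 fun i hi j hj => ?_
  simp only [mem_filter, mem_Ico] at hi hj
  have := h.eq_pos hx (i := i + 1) (by omega) (by omega) hi.2.1
  have := h.eq_pos hx (i := j + 1) (by omega) (by omega) hj.2.1
  omega

lemma descTop_le_one (h : IsWord n w pos) {x m : ℕ} (hx : 1 ≤ x) (hm : m ≤ n + 1) :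
    descTop w m x ≤ 1 := by
  refine card_le_one.2 fun i hi j hj => ?_
  simp only [mem_filter, mem_Ico] at hi hj
  rw [h.eq_pos hx hi.1.1 (by omega) hi.2.1, h.eq_pos hx hj.1.1 (by omega) hj.2.1]

lemma descBot_of_le (h : IsWord n w pos) {x m N : ℕ} (hx : 1 ≤ x) (hm : m ≤ N)
    (hN : N ≤ n + 1) : descBot w m x = if pos x ≤ m then descBot w N x else 0 := by
  split_ifs with hp
  · refine congrArg card (Finset.ext fun i => ?_)
    simp only [mem_filter, mem_Ico]
    refine ⟨fun hi => ⟨⟨hi.1.1, by omega⟩, hi.2⟩, fun hi => ⟨⟨hi.1.1, ?_⟩, hi.2⟩⟩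
    have := h.eq_pos hx (i := i + 1) (by omega) (by omega) hi.2.1
    omega
  · refine card_eq_zero.2 (filter_eq_empty_iff.2 fun i hi hi' => ?_)
    rw [mem_Ico] at hi
    have := h.eq_pos hx (i := i + 1) (by omega) (by omega) hi'.1
    omega

lemma descTop_of_le (h : IsWord n w pos) {x m N : ℕ} (hx : 1 ≤ x) (hm : m ≤ N)
    (hN : N ≤ n + 1) : descTop w m x = if pos x < m then descTop w N x else 0 := by
  split_ifs with hp
  · refine congrArg card (Finset.ext fun i => ?_)
    simp only [mem_filter, mem_Ico]
    refine ⟨fun hi => ⟨⟨hi.1.1, by omega⟩, hi.2⟩, fun hi => ⟨⟨hi.1.1, ?_⟩, hi.2⟩⟩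
    have := h.eq_pos hx hi.1.1 (by omega) hi.2.1
    omega
  · refine card_eq_zero.2 (filter_eq_empty_iff.2 fun i hi hi' => ?_)
    rw [mem_Ico] at hi
    have := h.eq_pos hx hi.1 (by omega) hi'.1
    omega

lemma downCross_top (h : IsWord n w pos) {m : ℕ} (hm : m ≤ n + 1) :
    downCross w (n + 1) m = 0 := by
  refine card_eq_zero.2 (filter_eq_empty_iff.2 fun i hi hi' => ?_)
  rw [mem_Ico] at hi
  have := h.apply_le hi.1 (by omega)
  omega

lemma downCross_pos_le_iff (h : IsWord n w pos) {x y : ℕ} (hy : 1 ≤ y) (hyx : y < x)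
    (hx : x ≤ n) : downCross w x (pos y) ≤ downCross w x (pos x) ↔ pos y < pos x := by
  refine ⟨fun hc => ?_, fun hp => downCross_mono w x hp.le⟩
  by_contra! hp
  have hpx := h.pos_mem x (by omega) hx
  rw [downCross_add w x hpx.1 hp, card_descents_through w x
    (h.apply_pos x (by omega) hx).ge hp, h.apply_pos y hy (by omega), if_pos hyx] at hc
  omega

/-- The left neighbour, right neighbour and left crossing data determine the crossing numbers
at all smaller values. -/
lemma downCross_pos_congr (h : IsWord n w pos) (h' : IsWord n w' pos') {N : ℕ} (hnN : n ≤ N)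
    (hN : N ≤ n + 1)
    (hB : ∀ x, 1 ≤ x → x ≤ n → descBot w N x = descBot w' N x)
    (hT : ∀ x, 1 ≤ x → x ≤ n → descTop w N x = descTop w' N x)
    (hC : ∀ x, 1 ≤ x → x ≤ n → downCross w x (pos x) = downCross w' x (pos' x))
    (x : ℕ) (hx : x ≤ n) (y : ℕ) (hy : 1 ≤ y) (hyx : y < x) :
    downCross w x (pos y) = downCross w' x (pos' y) := by
  induction x generalizing y with
  | zero => omega
  | succ x ih =>
    have hx1 : 1 ≤ x := by omega
    have hp := h.pos_mem y hy (by omega)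
    have hp' := h'.pos_mem y hy (by omega)
    have e := downCross_succ w x (pos y)
    have e' := downCross_succ w' x (pos' y)
    rw [h.descBot_of_le hx1 (m := pos y) (N := N) (by omega) hN,
      h.descTop_of_le hx1 (m := pos y) (N := N) (by omega) hN, hB x hx1 (by omega),
      hT x hx1 (by omega)] at e
    rw [h'.descBot_of_le hx1 (m := pos' y) (N := N) (by omega) hN,
      h'.descTop_of_le hx1 (m := pos' y) (N := N) (by omega) hN] at e'
    rcases Nat.lt_succ_iff_lt_or_eq.1 hyx with hlt | rfl
    · have hc := ih (by omega) y hy hlt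
      have o := h.downCross_pos_le_iff hy hlt (by omega)
      have o' := h'.downCross_pos_le_iff hy hlt (by omega)
      rw [hc, hC x hx1 (by omega)] at o
      have hne : pos y ≠ pos x := fun hq => by
        have := h.pos_inj hy (by omega) hx1 (by omega) hq
        omega
      have hne' : pos' y ≠ pos' x := fun hq => by
        have := h'.pos_inj hy (by omega) hx1 (by omega) hq
        omega
      split_ifs at e e' <;> omega
    · have hc := hC y hy (by omega)
      simp only [le_refl, lt_irrefl, if_true, if_false] at e e'
      omega

lemma pos_eq_card (h : IsWord n w pos) {x : ℕ} (hx : 1 ≤ x) (hxn : x ≤ n) :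
    pos x = ((Icc 1 n).filter fun y => pos y ≤ pos x).card := by
  have hp := h.pos_mem x hx hxn
  have : (Icc 1 (pos x)).card = ((Icc 1 n).filter fun y => pos y ≤ pos x).card := by
    refine card_nbij' w pos ?_ ?_ ?_ ?_
    · intro i hi
      simp only [coe_Icc, Set.mem_Icc] at hi
      have := h.apply_mem i hi.1 (by omega)
      have := h.pos_apply i hi.1 (by omega)
      simp only [coe_filter, mem_Icc, Set.mem_ofPred_eq]
      omega
    · intro y hy
      simp only [coe_filter, mem_Icc, Set.mem_ofPred_eq] at hy
      have := h.pos_mem y hy.1.1 hy.1.2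
      simp only [coe_Icc, Set.mem_Icc]
      omega
    · intro i hi
      simp only [coe_Icc, Set.mem_Icc] at hi
      exact h.pos_apply i hi.1 (by omega)
    · intro y hy
      simp only [coe_filter, mem_Icc, Set.mem_ofPred_eq] at hy
      exact h.apply_pos y hy.1.1 hy.1.2
  rw [← this, Nat.card_Icc, Nat.add_sub_cancel]

/-- The left neighbour, right neighbour and left crossing data determine the word. -/
lemma pos_congr (h : IsWord n w pos) (h' : IsWord n w' pos') {N : ℕ} (hnN : n ≤ N)
    (hN : N ≤ n + 1)
    (hB : ∀ x, 1 ≤ x → x ≤ n → descBot w N x = descBot w' N x)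
    (hT : ∀ x, 1 ≤ x → x ≤ n → descTop w N x = descTop w' N x)
    (hC : ∀ x, 1 ≤ x → x ≤ n → downCross w x (pos x) = downCross w' x (pos' x))
    (x : ℕ) (hx : 1 ≤ x) (hxn : x ≤ n) : pos x = pos' x := by
  have key : ∀ x y, 1 ≤ y → y < x → x ≤ n → (pos y < pos x ↔ pos' y < pos' x) := by
    intro x y hy hyx hx
    rw [← h.downCross_pos_le_iff hy hyx hx, ← h'.downCross_pos_le_iff hy hyx hx,
      downCross_pos_congr h h' hnN hN hB hT hC x hx y hy hyx, hC x (by omega) hx]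
  rw [h.pos_eq_card hx hxn, h'.pos_eq_card hx hxn]
  refine congrArg card (filter_congr fun y hy => ?_)
  rw [mem_Icc] at hy
  rcases lt_trichotomy x y with hxy | rfl | hxy
  · have := key y x hx hxy hy.2
    rw [← not_lt, ← not_lt, this]
  · simp
  · have := key x y hy.1 hxy hxn
    have : pos y ≠ pos x := fun hq => hxy.ne (h.pos_inj hy.1 hy.2 hx hxn hq)
    have : pos' y ≠ pos' x := fun hq => hxy.ne (h'.pos_inj hy.1 hy.2 hx hxn hq)
    omega

end IsWord

/-! ### The history of a word -/

/-- The history of a word at the `m` values `x, x + 1, …`. -/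
def wordHistory (w pos : ℕ → ℕ) (N : ℕ) : ℕ → ℕ → List Step
  | 0, _ => []
  | m + 1, x => ⟨(descBot w N x, descTop w N x), downCross w x (pos x)⟩ ::
      wordHistory w pos N m (x + 1)

lemma wordHistory_inj {w pos w' pos' : ℕ → ℕ} {N m x : ℕ}
    (h : wordHistory w pos N m x = wordHistory w' pos' N m x) (y : ℕ) (hy : x ≤ y)
    (hym : y < x + m) :
    descBot w N y = descBot w' N y ∧ descTop w N y = descTop w' N y ∧
      downCross w y (pos y) = downCross w' y (pos' y) := by
  induction m generalizing x with
  | zero => omega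
  | succ m ih =>
    simp only [wordHistory, List.cons.injEq, Sigma.mk.injEq, Prod.mk.injEq, heq_eq_eq] at h
    rcases hy.eq_or_lt with rfl | hlt
    · exact ⟨h.1.1.1, h.1.1.2, h.1.2⟩
    · exact ih h.2 hlt (by omega)

section

variable {n N : ℕ} {w pos : ℕ → ℕ} {β : ℕ → ℕ → ℕ} {e : ℕ → ℕ}

lemma downCross_succ_eq (w : ℕ → ℕ) (N x : ℕ) :
    downCross w (x + 1) N = downCross w x N + descBot w N x - descTop w N x := by
  have := downCross_succ w x N
  omega

lemma wordHistory_mem (h : IsWord n w pos) (hN : N ≤ n + 1)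
    (he : ∀ x, 1 ≤ x → x ≤ n →
      downCross w x (pos x) + e x + 1 = β (downCross w x N) (descTop w N x))
    (m x : ℕ) (hx : 1 ≤ x) (hxm : x + m = n + 1) :
    wordHistory w pos N m x ∈ histories β m (downCross w x N) := by
  induction m generalizing x with
  | zero =>
    obtain rfl : x = n + 1 := by omega
    simp [wordHistory, histories, h.downCross_top hN]
  | succ m ih =>
    rw [histories, mem_image]
    refine ⟨⟨⟨(descBot w N x, descTop w N x), downCross w x (pos x)⟩,
      wordHistory w pos N m (x + 1)⟩, ?_, rfl⟩
    rw [mem_sigma, steps, mem_sigma, mem_product]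
    simp only [mem_range]
    have h1 := h.descBot_le_one hx hN
    have h2 := h.descTop_le_one hx hN
    have h3 := he x hx (by omega)
    refine ⟨⟨⟨by omega, by omega⟩, by omega⟩, ?_⟩
    rw [← downCross_succ_eq]
    exact ih (x + 1) (by omega) (by omega)

lemma historyWeight_wordHistory {R : Type*} [CommSemiring R] (p q t : R)
    (he : ∀ x, 1 ≤ x → x ≤ n →
      downCross w x (pos x) + e x + 1 = β (downCross w x N) (descTop w N x))
    (m x : ℕ) (hx : 1 ≤ x) (hxm : x + m = n + 1) :
    historyWeight β p q t (downCross w x N) (wordHistory w pos N m x) =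
      p ^ (∑ y ∈ Ico x (n + 1), e y) * q ^ (∑ y ∈ Ico x (n + 1), downCross w y (pos y)) *
        t ^ (∑ y ∈ Ico x (n + 1), descTop w N y) := by
  induction m generalizing x with
  | zero =>
    obtain rfl : x = n + 1 := by omega
    simp [wordHistory, historyWeight]
  | succ m ih =>
    have hlt : x < n + 1 := by omega
    have h3 := he x hx (by omega)
    rw [wordHistory, historyWeight]
    simp only [stepWeight]
    rw [← downCross_succ_eq, ih (x + 1) (by omega) (by omega), ← h3,
      sum_eq_sum_Ico_succ_bot hlt, sum_eq_sum_Ico_succ_bot hlt, sum_eq_sum_Ico_succ_bot hlt,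
      show downCross w x (pos x) + e x + 1 - 1 - downCross w x (pos x) = e x by omega]
    ring

end

/-! ### Permutations -/

lemma pext_of_mem {n : ℕ} (σ : Equiv.Perm (Fin n)) {i : ℕ} (hi : 1 ≤ i) (hin : i ≤ n) :
    pext n σ i = (σ ⟨i - 1, by omega⟩ : ℕ) + 1 := by
  rw [pext, dif_pos ⟨hi, hin⟩]

lemma pext_mem {n : ℕ} (σ : Equiv.Perm (Fin n)) {i : ℕ} (hi : 1 ≤ i) (hin : i ≤ n) :
    1 ≤ pext n σ i ∧ pext n σ i ≤ n := by
  rw [pext_of_mem σ hi hin]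
  have := (σ ⟨i - 1, by omega⟩).isLt
  omega

lemma pext_inv_pext {n : ℕ} (σ : Equiv.Perm (Fin n)) {i : ℕ} (hi : 1 ≤ i) (hin : i ≤ n) :
    pext n σ⁻¹ (pext n σ i) = i := by
  have h := pext_mem σ hi hin
  rw [pext_of_mem σ⁻¹ h.1 h.2]
  simp only [pext_of_mem σ hi hin, Nat.add_sub_cancel, Fin.eta, Equiv.Perm.coe_inv, Equiv.symm_apply_apply]
  omega

lemma isWord_pext {n : ℕ} (σ : Equiv.Perm (Fin n)) :
    IsWord n (pext n σ) (pext n σ⁻¹) where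
  pos_mem _ := pext_mem σ⁻¹
  apply_pos x hx hxn := by simpa using pext_inv_pext σ⁻¹ hx hxn
  apply_mem _ := pext_mem σ
  pos_apply _ := pext_inv_pext σ
  apply_end := by simp [pext]

lemma perm_ext_pext {n : ℕ} {σ τ : Equiv.Perm (Fin n)}
    (h : ∀ x, 1 ≤ x → x ≤ n → pext n σ x = pext n τ x) : σ = τ := by
  ext i
  have := h (i + 1) (by omega) (by omega)
  rw [pext_of_mem σ (by omega) (by omega), pext_of_mem τ (by omega) (by omega)] at this
  simpa using this

/-- Summation over permutations through their histories. -/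
lemma sum_perm_eq_pathSum {R : Type*} [CommSemiring R] (p q t : R) {n N k : ℕ}
    {β : ℕ → ℕ → ℕ} (hnN : n ≤ N) (hN : N ≤ n + 1) (e : Equiv.Perm (Fin n) → ℕ → ℕ)
    (he : ∀ σ x, 1 ≤ x → x ≤ n → downCross (pext n σ) x (pext n σ⁻¹ x) + e σ x + 1 =
      β (downCross (pext n σ) x N) (descTop (pext n σ) N x))
    (hk : ∀ σ, downCross (pext n σ) 1 N = k)
    (hcard : pathSum β (1 : ℕ) 1 1 n k = n.factorial) :
    ∑ σ : Equiv.Perm (Fin n), p ^ (∑ x ∈ Ico 1 (n + 1), e σ x) *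
      q ^ (∑ x ∈ Ico 1 (n + 1), downCross (pext n σ) x (pext n σ⁻¹ x)) *
      t ^ (∑ x ∈ Ico 1 (n + 1), descTop (pext n σ) N x) = pathSum β p q t n k := by
  set φ : Equiv.Perm (Fin n) → List Step :=
    fun σ => wordHistory (pext n σ) (pext n σ⁻¹) N n 1 with hφ
  have hinj : Function.Injective φ := by
    intro σ τ h
    have key := wordHistory_inj h
    refine inv_injective (perm_ext_pext fun x hx hxn => ?_)
    exact (isWord_pext σ).pos_congr (isWord_pext τ) hnN hN
      (fun y h1 h2 => (key y h1 (by omega)).1) (fun y h1 h2 => (key y h1 (by omega)).2.1)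
      (fun y h1 h2 => (key y h1 (by omega)).2.2) x hx hxn
  have himage : univ.image φ = histories β n k := by
    refine eq_of_subset_of_card_le (fun l hl => ?_) ?_
    · obtain ⟨σ, -, rfl⟩ := mem_image.1 hl
      rw [← hk σ]
      exact wordHistory_mem (isWord_pext σ) hN (he σ) n 1 le_rfl (by omega)
    · rw [card_histories, hcard, card_image_of_injective _ hinj, card_univ,
        Fintype.card_perm, Fintype.card_fin]
  rw [← sum_historyWeight, ← himage, sum_image hinj.injOn]
  refine sum_congr rfl fun σ _ => ?_
  rw [← hk σ]
  exact (historyWeight_wordHistory p q t (he σ) n 1 le_rfl (by omega)).symm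

/-! ### The statistics in terms of crossings -/

lemma sum_pext_inv {n : ℕ} (σ : Equiv.Perm (Fin n)) (f : ℕ → ℕ → ℕ) :
    ∑ i ∈ Icc 1 n, f i (pext n σ i) = ∑ x ∈ Ico 1 (n + 1), f (pext n σ⁻¹ x) x := by
  have h := isWord_pext σ
  refine sum_nbij' (pext n σ) (pext n σ⁻¹) ?_ ?_ ?_ ?_ ?_
  · intro i hi
    rw [mem_Icc] at hi
    have := h.apply_mem i hi.1 hi.2
    rw [mem_Ico]
    omega
  · intro x hx
    rw [mem_Ico] at hx
    have := h.pos_mem x hx.1 (by omega)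
    rwa [mem_Icc]
  · intro i hi
    rw [mem_Icc] at hi
    exact h.pos_apply i hi.1 hi.2
  · intro x hx
    rw [mem_Ico] at hx
    exact h.apply_pos x hx.1 (by omega)
  · intro i hi
    rw [mem_Icc] at hi
    rw [h.pos_apply i hi.1 hi.2]

lemma lesStat_eq_sum {n : ℕ} (σ : Equiv.Perm (Fin n)) :
    lesStat n σ = ∑ x ∈ Ico 1 (n + 1), downCross (pext n σ) x (pext n σ⁻¹ x) := by
  rw [← sum_pext_inv σ fun j x => downCross (pext n σ) x j, lesStat, pairs, card_filter,
    sum_product_right]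
  refine sum_congr rfl fun j hj => ?_
  rw [mem_Icc] at hj
  rw [← card_filter, downCross]
  refine card_nbij' (· - 1) (· + 1) ?_ ?_ ?_ ?_
  · intro i hi
    simp only [coe_filter, mem_Icc, Set.mem_ofPred_eq, mem_Ico] at hi ⊢
    rw [Nat.sub_add_cancel hi.1.1]
    omega
  · intro i hi
    simp only [coe_filter, mem_Icc, Set.mem_ofPred_eq, mem_Ico, Nat.add_sub_cancel] at hi ⊢
    have h1 : i + 1 ≠ j := by
      rintro rfl
      omega
    have h2 : pext n σ i ≠ pext n σ j := fun hq => by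
      have := pext_inv_pext σ (i := i) (by omega) (by omega)
      rw [hq, pext_inv_pext σ hj.1 hj.2] at this
      omega
    omega
  · intro i hi
    simp only [coe_filter, mem_Icc, Set.mem_ofPred_eq] at hi
    exact Nat.sub_add_cancel hi.1.1
  · intro i _
    exact Nat.add_sub_cancel i 1

/-- The contribution of the value `x` at position `i` to `ress`. -/
def ressAt (w : ℕ → ℕ) (n i x : ℕ) : ℕ :=
  ((Ico (i + 1) n).filter fun j => w (j + 1) < x ∧ x < w j).card

/-- The contribution of the value `x` at position `i` to `res`. -/
def resAt (w : ℕ → ℕ) (n i x : ℕ) : ℕ :=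
  ((Ico (i + 1) n).filter fun j => w j < x ∧ x < w (j + 1)).card

lemma ressStat_eq_sum {n : ℕ} (σ : Equiv.Perm (Fin n)) :
    ressStat n σ = ∑ x ∈ Ico 1 (n + 1), ressAt (pext n σ) n (pext n σ⁻¹ x) x := by
  rw [← sum_pext_inv σ fun i x => ressAt (pext n σ) n i x, ressStat, pairs, card_filter,
    sum_product]
  refine sum_congr rfl fun i hi => ?_
  rw [mem_Icc] at hi
  rw [← card_filter, ressAt]
  refine congrArg card (Finset.ext fun j => ?_)
  simp only [mem_filter, mem_Icc, mem_Ico]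
  omega

lemma resStat_eq_sum {n : ℕ} (σ : Equiv.Perm (Fin n)) :
    resStat n σ = ∑ x ∈ Ico 1 (n + 1), resAt (pext n σ) n (pext n σ⁻¹ x) x := by
  rw [← sum_pext_inv σ fun i x => resAt (pext n σ) n i x, resStat, pairs, card_filter,
    sum_product]
  refine sum_congr rfl fun i hi => ?_
  rw [mem_Icc] at hi
  rw [← card_filter, resAt]
  refine congrArg card (Finset.ext fun j => ?_)
  simp only [mem_filter, mem_Icc, mem_Ico]
  omega

lemma sum_descTop {n N : ℕ} {w pos : ℕ → ℕ} (h : IsWord n w pos) (hN : N ≤ n + 1) :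
    ∑ x ∈ Ico 1 (n + 1), descTop w N x =
      ((Ico 1 N).filter fun i => w (i + 1) < w i).card := by
  rw [card_eq_sum_card_fiberwise (f := w) (t := Ico 1 (n + 1))]
  · refine sum_congr rfl fun x _ => ?_
    rw [descTop, filter_filter]
    refine congrArg card (filter_congr fun i _ => ?_)
    constructor
    · rintro ⟨rfl, h2⟩
      exact ⟨h2, rfl⟩
    · rintro ⟨h2, rfl⟩
      exact ⟨rfl, h2⟩
  · intro i hi
    simp only [coe_filter, mem_Ico, Set.mem_ofPred_eq] at hi
    have := h.apply_le (i := i) hi.1.1 (by omega)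
    simp only [coe_Ico, Set.mem_Ico]
    omega

lemma desStat_eq_sum {n : ℕ} (σ : Equiv.Perm (Fin n)) :
    ∑ x ∈ Ico 1 (n + 1), descTop (pext n σ) n x = desStat n σ := by
  rw [sum_descTop (isWord_pext σ) (by omega), desStat]
  refine congrArg card (Finset.ext fun i => ?_)
  simp only [mem_filter, mem_Icc, mem_Ico]
  omega

lemma desStat_succ_eq_sum {n : ℕ} (hn : 1 ≤ n) (σ : Equiv.Perm (Fin n)) :
    ∑ x ∈ Ico 1 (n + 1), descTop (pext n σ) (n + 1) x = desStat n σ + 1 := by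
  have h := isWord_pext σ
  have hlast := h.apply_mem n hn le_rfl
  rw [← desStat_eq_sum, sum_descTop h le_rfl, sum_descTop h (by omega), card_filter,
    sum_Ico_succ_top hn, ← card_filter, if_pos (by rw [h.apply_end]; omega)]

lemma downCross_add_ressAt {n : ℕ} {w pos : ℕ → ℕ} (h : IsWord n w pos) {x : ℕ}
    (hx : 1 ≤ x) (hxn : x ≤ n) :
    downCross w x (pos x) + ressAt w n (pos x) x + 1 =
      ressLabels (downCross w x n) (descTop w n x) := by
  have hp := h.pos_mem x hx hxn
  have hT : descTop w n x + ressAt w n (pos x) x =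
      ((Ico (pos x) n).filter fun i => w (i + 1) < x ∧ x ≤ w i).card := by
    rw [descTop, ressAt, ← card_union_of_disjoint]
    · refine congrArg card (Finset.ext fun i => ?_)
      simp only [mem_union, mem_filter, mem_Ico]
      constructor
      · rintro (hi | hi)
        · have := h.eq_pos hx hi.1.1 (by omega) hi.2.1
          omega
        · omega
      · intro hi
        by_cases hw : w i = x
        · exact Or.inl ⟨by omega, hw, hi.2.1⟩
        · have : i ≠ pos x := by
            rintro rfl
            exact hw (h.apply_pos x hx hxn)
          exact Or.inr (by omega)
    · refine disjoint_left.2 fun i hi hi' => ?_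
      simp only [mem_filter, mem_Ico] at hi hi'
      omega
  have := downCross_add w x hp.1 hp.2
  rw [ressLabels]
  omega

lemma downCross_add_resAt {n : ℕ} {w pos : ℕ → ℕ} (h : IsWord n w pos) {x : ℕ}
    (hx : 1 ≤ x) (hxn : x ≤ n) :
    downCross w x (pos x) + resAt w n (pos x) x + 1 =
      resLabels (downCross w x (n + 1)) (descTop w (n + 1) x) := by
  have hp := h.pos_mem x hx hxn
  have hw := h.apply_pos x hx hxn
  have h1 := downCross_add w x hp.1 (m' := n + 1) (by omega)
  have h2 := card_descents_through w x hw.ge (m := n + 1) (by omega)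
  rw [if_pos (by rw [h.apply_end]; omega)] at h2
  have h3 : ((Ico (pos x) (n + 1)).filter fun i => w i < x ∧ x ≤ w (i + 1)).card =
      resAt w n (pos x) x := by
    refine congrArg card (Finset.ext fun i => ?_)
    simp only [mem_filter, mem_Ico]
    constructor
    · intro hi
      have hne : i ≠ pos x := by
        rintro rfl
        omega
      have hne' : i ≠ n := by
        rintro rfl
        have := h.apply_end
        omega
      have : w (i + 1) ≠ x := fun hq => by
        have := h.eq_pos hx (i := i + 1) (by omega) (by omega) hq
        omega
      omega
    · omega
  rw [resLabels]
  omega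

lemma downCross_one {n : ℕ} {w pos : ℕ → ℕ} (h : IsWord n w pos) : downCross w 1 n = 0 := by
  refine card_eq_zero.2 (filter_eq_empty_iff.2 fun i hi hi' => ?_)
  rw [mem_Ico] at hi
  have := h.apply_mem (i + 1) (by omega) (by omega)
  omega

lemma downCross_one_succ {n : ℕ} {w pos : ℕ → ℕ} (hn : 1 ≤ n) (h : IsWord n w pos) :
    downCross w 1 (n + 1) = 1 := by
  have h0 := downCross_one h
  have hlast := h.apply_mem n hn le_rfl
  rw [downCross, card_filter] at h0 ⊢
  rw [sum_Ico_succ_top hn, h0, if_pos ⟨by rw [h.apply_end]; omega, hlast.1⟩]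

lemma sum_ress {R : Type*} [CommSemiring R] (p q t : R) (n : ℕ) :
    ∑ σ : Equiv.Perm (Fin n), p ^ ressStat n σ * q ^ lesStat n σ * t ^ desStat n σ =
      pathSum ressLabels p q t n 0 := by
  rw [← sum_perm_eq_pathSum p q t le_rfl (Nat.le_succ n)
    (fun σ x => ressAt (pext n σ) n (pext n σ⁻¹ x) x)
    (fun σ x => downCross_add_ressAt (isWord_pext σ))
    (fun σ => downCross_one (isWord_pext σ))
    (by simp [pathSum_ressLabels_one_one_one])]
  refine sum_congr rfl fun σ _ => ?_
  rw [← ressStat_eq_sum, ← lesStat_eq_sum, desStat_eq_sum]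

lemma sum_res {R : Type*} [CommSemiring R] (p q t : R) {n : ℕ} (hn : 1 ≤ n) :
    ∑ σ : Equiv.Perm (Fin n), p ^ resStat n σ * q ^ lesStat n σ * t ^ (desStat n σ + 1) =
      pathSum resLabels p q t n 1 := by
  rw [← sum_perm_eq_pathSum p q t (Nat.le_succ n) le_rfl
    (fun σ x => resAt (pext n σ) n (pext n σ⁻¹ x) x)
    (fun σ x => downCross_add_resAt (isWord_pext σ))
    (fun σ => downCross_one_succ hn (isWord_pext σ))
    (by simp [pathSum_resLabels_one _ _ _ n hn, pathSum_ressLabels_one_one_one])]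
  refine sum_congr rfl fun σ _ => ?_
  rw [← resStat_eq_sum, ← lesStat_eq_sum, desStat_succ_eq_sum hn]

open MvPolynomial in
theorem statement13 (n : ℕ) (hn : 1 ≤ n) :
    (∑ σ : Equiv.Perm (Fin n),
        (X 0 : MvPolynomial (Fin 3) ℤ) ^ resStat n σ * X 1 ^ lesStat n σ *
          X 2 ^ desStat n σ) =
    ∑ σ : Equiv.Perm (Fin n),
        (X 0 : MvPolynomial (Fin 3) ℤ) ^ ressStat n σ * X 1 ^ lesStat n σ *
          X 2 ^ desStat n σ := by
  refine mul_left_cancel₀ (X_ne_zero (R := ℤ) (2 : Fin 3)) ?_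
  rw [sum_ress, ← pathSum_resLabels_one _ _ _ n hn, ← sum_res _ _ _ hn, mul_sum]
  refine sum_congr rfl fun σ _ => ?_
  ring

end SZpaper
end
end
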